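/- For every integer n ≥ 2, the diagonal invariant ideal I^{(1,0)} of the dihedral group I₂(n) acting on MvPolynomial (Fin 2) ℂ equals the ideal generated by the two elements X₀² + X₁² and X₀^n. -/

import Mathlib

open MvPolynomial

/-- The action of the rotation ρ (by 2π/n) of the dihedral group I₂(n) on one set
of two variables X₀, X₁. -/
noncomputable def sigmaRho (n : ℕ) :
    MvPolynomial (Fin 2) ℂ →ₐ[ℂ] MvPolynomial (Fin 2) ℂ :=
  aeval fun v =>
    if v = 0 then
      (Real.cos (2 * Real.pi / n) : ℂ) • X (0 : Fin 2)
        - (Real.sin (2 * Real.pi / n) : ℂ) • X (1 : Fin 2)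
    else
      (Real.sin (2 * Real.pi / n) : ℂ) • X (0 : Fin 2)
        + (Real.cos (2 * Real.pi / n) : ℂ) • X (1 : Fin 2)

/-- The action of the reflection φ of the dihedral group I₂(n). -/
noncomputable def sigmaPhi : MvPolynomial (Fin 2) ℂ →ₐ[ℂ] MvPolynomial (Fin 2) ℂ :=
  aeval fun v : Fin 2 => if v = 0 then X (0 : Fin 2) else - X (1 : Fin 2)

/-- The invariant ideal I^{(1,0)} of the dihedral group I₂(n). -/
noncomputable def dihedralIdeal (n : ℕ) : Ideal (MvPolynomial (Fin 2) ℂ) :=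
  Ideal.span { p | sigmaRho n p = p ∧ sigmaPhi p = p ∧ constantCoeff p = 0 }

/-- The cross terms of `(a + b) ^ m` are all divisible by `a * b`. -/
theorem mul_dvd_add_pow_sub {R : Type*} [CommRing R] (a b : R) {m : ℕ} (hm : 1 ≤ m) :
    a * b ∣ (a + b) ^ m - (a ^ m + b ^ m) := by
  induction m, hm using Nat.le_induction with
  | base => simp
  | succ m hm ih =>
    obtain ⟨k, hk⟩ := ih
    obtain ⟨l, rfl⟩ := Nat.exists_eq_add_of_le' hm
    refine ⟨(a + b) * k + a ^ l + b ^ l, ?_⟩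
    linear_combination (a + b) * hk

namespace DihedralIdeal

/-- The isotropic coordinate `X₀ + i X₁`. -/
noncomputable def z : MvPolynomial (Fin 2) ℂ := X 0 + C Complex.I * X 1

/-- The isotropic coordinate `X₀ - i X₁`. -/
noncomputable def w : MvPolynomial (Fin 2) ℂ := X 0 - C Complex.I * X 1

theorem C_I_sq : (C Complex.I : MvPolynomial (Fin 2) ℂ) ^ 2 = -1 := by
  rw [← C_pow, Complex.I_sq, C_neg, C_1]

theorem C_half_mul_two : (C (1 / 2) : MvPolynomial (Fin 2) ℂ) * 2 = 1 := by
  rw [← map_ofNat (C : ℂ →+* MvPolynomial (Fin 2) ℂ) 2, ← C_mul]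
  norm_num

theorem z_mul_w : z * w = X 0 ^ 2 + X 1 ^ 2 := by
  unfold z w
  linear_combination (-X 1 ^ 2) * C_I_sq

theorem z_add_w : z + w = 2 * X 0 := by
  unfold z w
  ring

theorem constantCoeff_z : constantCoeff z = 0 := by simp [z]

theorem constantCoeff_w : constantCoeff w = 0 := by simp [w]

/-- The rotation angle `2π/n` as a point of the unit circle. -/
noncomputable def zeta (n : ℕ) : ℂ := Complex.exp (2 * Real.pi * Complex.I / n)

theorem zeta_eq (n : ℕ) :
    zeta n = (Real.cos (2 * Real.pi / n) : ℂ) + (Real.sin (2 * Real.pi / n) : ℂ) * Complex.I := by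
  rw [zeta, Complex.ofReal_cos, Complex.ofReal_sin, ← Complex.exp_mul_I]
  push_cast
  ring_nf

theorem zeta_inv_eq (n : ℕ) :
    (zeta n)⁻¹ =
      (Real.cos (2 * Real.pi / n) : ℂ) - (Real.sin (2 * Real.pi / n) : ℂ) * Complex.I := by
  have h : (Real.cos (2 * Real.pi / n) : ℂ) ^ 2 + (Real.sin (2 * Real.pi / n) : ℂ) ^ 2 = 1 :=
    mod_cast Real.cos_sq_add_sin_sq _
  rw [zeta_eq]
  refine inv_eq_of_mul_eq_one_right ?_
  linear_combination h - (Real.sin (2 * Real.pi / n) : ℂ) ^ 2 * Complex.I_sq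

theorem isPrimitiveRoot_zeta {n : ℕ} (hn : n ≠ 0) : IsPrimitiveRoot (zeta n) n :=
  Complex.isPrimitiveRoot_exp n hn

theorem sigmaRho_z (n : ℕ) : sigmaRho n z = C (zeta n) * z := by
  simp only [sigmaRho, z, zeta_eq, map_add, map_mul, aeval_X, algHom_C, algebraMap_eq,
    smul_eq_C_mul, if_true, one_ne_zero, if_false]
  linear_combination (-C (Real.sin (2 * Real.pi / n) : ℂ) * X 1) * C_I_sq

theorem sigmaRho_w (n : ℕ) : sigmaRho n w = C (zeta n)⁻¹ * w := by
  simp only [sigmaRho, w, zeta_inv_eq, map_sub, map_mul, aeval_X, algHom_C, algebraMap_eq,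
    smul_eq_C_mul, if_true, one_ne_zero, if_false]
  linear_combination (-C (Real.sin (2 * Real.pi / n) : ℂ) * X 1) * C_I_sq

theorem sigmaPhi_z : sigmaPhi z = w := by
  simp [sigmaPhi, z, w, algHom_C, algebraMap_eq, sub_eq_add_neg]

theorem sigmaPhi_w : sigmaPhi w = z := by
  simp [sigmaPhi, z, w, algHom_C, algebraMap_eq]

theorem z_mul_w_mem {n : ℕ} : z * w ∈ dihedralIdeal n := by
  refine Ideal.subset_span ⟨?_, ?_, ?_⟩
  · have h : (C (zeta n) : MvPolynomial (Fin 2) ℂ) * C (zeta n)⁻¹ = 1 := by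
      rw [← C_mul, mul_inv_cancel₀ (show zeta n ≠ 0 from Complex.exp_ne_zero _), C_1]
    rw [map_mul, sigmaRho_z, sigmaRho_w]
    linear_combination z * w * h
  · rw [map_mul, sigmaPhi_z, sigmaPhi_w, mul_comm]
  · rw [map_mul, constantCoeff_z, zero_mul]

theorem z_pow_add_w_pow_mem {n : ℕ} (hn : n ≠ 0) : z ^ n + w ^ n ∈ dihedralIdeal n := by
  refine Ideal.subset_span ⟨?_, ?_, ?_⟩
  · rw [map_add, map_pow, map_pow, sigmaRho_z, sigmaRho_w, mul_pow, mul_pow, ← C_pow, ← C_pow,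
      inv_pow, (isPrimitiveRoot_zeta hn).pow_eq_one, inv_one, C_1, one_mul, one_mul]
  · rw [map_add, map_pow, map_pow, sigmaPhi_z, sigmaPhi_w, add_comm]
  · rw [map_add, map_pow, map_pow, constantCoeff_z, constantCoeff_w, zero_pow hn, add_zero]

/-- Restriction to the line `w = 0`, parametrised by `z`. -/
noncomputable def restrictZ : MvPolynomial (Fin 2) ℂ →ₐ[ℂ] Polynomial ℂ :=
  aeval fun v : Fin 2 =>
    if v = 0 then Polynomial.C (1 / 2) * Polynomial.X
    else Polynomial.C (-Complex.I / 2) * Polynomial.X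

/-- Restriction to the line `z = 0`, parametrised by `w`. -/
noncomputable def restrictW : MvPolynomial (Fin 2) ℂ →ₐ[ℂ] Polynomial ℂ :=
  restrictZ.comp sigmaPhi

theorem restrictZ_X_zero : restrictZ (X 0) = Polynomial.C (1 / 2) * Polynomial.X := by
  simp [restrictZ]

theorem restrictZ_X_one : restrictZ (X 1) = Polynomial.C (-Complex.I / 2) * Polynomial.X := by
  simp [restrictZ]

theorem restrictW_X_zero : restrictW (X 0) = Polynomial.C (1 / 2) * Polynomial.X := by
  simp [restrictW, sigmaPhi, restrictZ_X_zero]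

theorem restrictW_X_one : restrictW (X 1) = Polynomial.C (Complex.I / 2) * Polynomial.X := by
  simp [restrictW, sigmaPhi, restrictZ_X_one, neg_div]

theorem restrictZ_w : restrictZ w = 0 := by
  rw [w, map_sub, map_mul, restrictZ_X_zero, restrictZ_X_one, algHom_C,
    Polynomial.algebraMap_eq, ← mul_assoc, ← Polynomial.C_mul, ← sub_mul, ← Polynomial.C_sub]
  have h : (1 / 2 : ℂ) - Complex.I * (-Complex.I / 2) = 0 := by
    linear_combination (1 / 2 : ℂ) * Complex.I_sq
  rw [h, Polynomial.C_0, zero_mul]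

theorem restrictW_z : restrictW z = 0 := by
  rw [restrictW, AlgHom.comp_apply, sigmaPhi_z, restrictZ_w]

theorem restrictW_w : restrictW w = Polynomial.X := by
  rw [w, map_sub, map_mul, restrictW_X_zero, restrictW_X_one, algHom_C,
    Polynomial.algebraMap_eq, ← mul_assoc, ← Polynomial.C_mul, ← sub_mul, ← Polynomial.C_sub]
  have h : (1 / 2 : ℂ) - Complex.I * (Complex.I / 2) = 1 := by
    linear_combination (-1 / 2 : ℂ) * Complex.I_sq
  rw [h, Polynomial.C_1, one_mul]

theorem restrictZ_sigmaRho (n : ℕ) (p : MvPolynomial (Fin 2) ℂ) :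
    restrictZ (sigmaRho n p) = (restrictZ p).comp (Polynomial.C (zeta n) * Polynomial.X) := by
  have h : restrictZ.comp (sigmaRho n) =
      (Polynomial.aeval (Polynomial.C (zeta n) * Polynomial.X)).comp restrictZ := by
    refine algHom_ext fun v => ?_
    have hI : (Polynomial.C Complex.I : Polynomial ℂ) ^ 2 = -1 := by
      rw [← Polynomial.C_pow, Complex.I_sq, Polynomial.C_neg, Polynomial.C_1]
    fin_cases v
    · simp [sigmaRho, restrictZ_X_zero, restrictZ_X_one, zeta_eq, Polynomial.smul_eq_C_mul,
        div_eq_mul_inv]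
      ring
    · simp [sigmaRho, restrictZ_X_zero, restrictZ_X_one, zeta_eq, Polynomial.smul_eq_C_mul,
        div_eq_mul_inv]
      linear_combination (Polynomial.C (Complex.sin (2 * Real.pi * (n : ℂ)⁻¹)) *
        Polynomial.C (2⁻¹) * Polynomial.X) * hI
  exact DFunLike.congr_fun h p

theorem coeff_zero_restrictZ (p : MvPolynomial (Fin 2) ℂ) :
    (restrictZ p).coeff 0 = constantCoeff p := by
  have h : (Polynomial.constantCoeff : Polynomial ℂ →+* ℂ).comp restrictZ.toRingHom =
      constantCoeff := by
    refine MvPolynomial.ringHom_ext (fun r => ?_) fun v => ?_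
    · simp [algHom_C]
    · fin_cases v <;> simp [restrictZ_X_zero, restrictZ_X_one]
  exact RingHom.congr_fun h p

/-- An algebra endomorphism that fixes both variables modulo an ideal fixes everything modulo it. -/
theorem sub_map_mem {σ R : Type*} [CommRing R] (f : MvPolynomial σ R →ₐ[R] MvPolynomial σ R)
    (J : Ideal (MvPolynomial σ R)) (h : ∀ v, X v - f (X v) ∈ J) (p : MvPolynomial σ R) :
    p - f p ∈ J := by
  have hf : (Ideal.Quotient.mkₐ R J).comp f = Ideal.Quotient.mkₐ R J :=
    algHom_ext fun v => (Ideal.Quotient.eq.2 (h v)).symm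
  exact Ideal.Quotient.eq.1 (DFunLike.congr_fun hf p).symm

theorem w_dvd_sub (p : MvPolynomial (Fin 2) ℂ) :
    w ∣ p - Polynomial.aeval z (restrictZ p) := by
  rw [← Ideal.mem_span_singleton]
  refine sub_map_mem ((Polynomial.aeval z).comp restrictZ) _ (fun v => ?_) p
  rw [Ideal.mem_span_singleton]
  fin_cases v
  · refine ⟨C (1 / 2), ?_⟩
    simp only [Fin.zero_eta, AlgHom.comp_apply, restrictZ_X_zero, map_mul, Polynomial.aeval_C,
      Polynomial.aeval_X, algebraMap_eq]
    linear_combination -X 0 * C_half_mul_two - C (1 / 2) * z_add_w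
  · refine ⟨C (1 / 2) * C Complex.I, ?_⟩
    have h : (-Complex.I / 2) = -(1 / 2 * Complex.I) := by ring
    simp only [Fin.mk_one, AlgHom.comp_apply, restrictZ_X_one, map_mul, Polynomial.aeval_C,
      Polynomial.aeval_X, algebraMap_eq, h, map_neg, z, w]
    linear_combination -X 1 * C_half_mul_two + (2 * C (1 / 2) * X 1) * C_I_sq

theorem z_dvd_sub (p : MvPolynomial (Fin 2) ℂ) :
    z ∣ p - Polynomial.aeval w (restrictW p) := by
  rw [← Ideal.mem_span_singleton]
  refine sub_map_mem ((Polynomial.aeval w).comp restrictW) _ (fun v => ?_) p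
  rw [Ideal.mem_span_singleton]
  fin_cases v
  · refine ⟨C (1 / 2), ?_⟩
    simp only [Fin.zero_eta, AlgHom.comp_apply, restrictW_X_zero, map_mul, Polynomial.aeval_C,
      Polynomial.aeval_X, algebraMap_eq]
    linear_combination -X 0 * C_half_mul_two - C (1 / 2) * z_add_w
  · refine ⟨-(C (1 / 2) * C Complex.I), ?_⟩
    have h : (Complex.I / 2) = 1 / 2 * Complex.I := by ring
    simp only [Fin.mk_one, AlgHom.comp_apply, restrictW_X_one, map_mul, Polynomial.aeval_C,
      Polynomial.aeval_X, algebraMap_eq, h, z, w]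
    linear_combination -X 1 * C_half_mul_two + (2 * C (1 / 2) * X 1) * C_I_sq

/-- A polynomial without constant term is the sum of its restrictions to the lines `w = 0` and
`z = 0`, modulo `z * w`. -/
theorem z_mul_w_dvd_sub {p : MvPolynomial (Fin 2) ℂ} (hp : constantCoeff p = 0) :
    z * w ∣ p - (Polynomial.aeval z (restrictZ p) + Polynomial.aeval w (restrictW p)) := by
  obtain ⟨u, hu⟩ := w_dvd_sub p
  obtain ⟨v, hv⟩ := z_dvd_sub u
  have h0 : restrictW (Polynomial.aeval z (restrictZ p)) = 0 := by
    rw [← Polynomial.aeval_algHom_apply, restrictW_z, Polynomial.aeval_def,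
      Polynomial.eval₂_at_zero, coeff_zero_restrictZ, hp, map_zero]
  have h1 : Polynomial.aeval w (restrictW p) = w * Polynomial.aeval w (restrictW u) := by
    rw [sub_eq_iff_eq_add.1 hu, map_add, h0, add_zero, map_mul, restrictW_w, map_mul,
      Polynomial.aeval_X]
  refine ⟨v, ?_⟩
  linear_combination hu - h1 + w * hv

theorem aeval_z_add_aeval_w_mem {n : ℕ} {h : Polynomial ℂ} (h0 : h.coeff 0 = 0)
    (hdvd : ∀ i, h.coeff i ≠ 0 → n ∣ i) :
    Polynomial.aeval z h + Polynomial.aeval w h ∈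
      Ideal.span ({X 0 ^ 2 + X 1 ^ 2, X 0 ^ n} : Set (MvPolynomial (Fin 2) ℂ)) := by
  rw [Polynomial.aeval_eq_sum_range, Polynomial.aeval_eq_sum_range, ← Finset.sum_add_distrib]
  refine Ideal.sum_mem _ fun i _ => ?_
  by_cases hi : h.coeff i = 0
  · simp [hi]
  have hi0 : 1 ≤ i := Nat.one_le_iff_ne_zero.2 fun h' => hi (h' ▸ h0)
  obtain ⟨k, hk⟩ := mul_dvd_add_pow_sub z w hi0
  obtain ⟨l, hl⟩ := pow_dvd_pow (X 0 : MvPolynomial (Fin 2) ℂ) (Nat.le_of_dvd hi0 (hdvd i hi))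
  rw [z_add_w, z_mul_w, mul_pow, hl] at hk
  rw [← smul_add, smul_eq_C_mul]
  refine Ideal.mul_mem_left _ _ (Ideal.mem_span_pair.2 ⟨-k, 2 ^ i * l, ?_⟩)
  linear_combination hk

end DihedralIdeal

open DihedralIdeal in
theorem dihedral_ideal_generators (n : ℕ) (hn : 2 ≤ n) :
    dihedralIdeal n =
      Ideal.span ({X 0 ^ 2 + X 1 ^ 2, X 0 ^ n} : Set (MvPolynomial (Fin 2) ℂ)) := by
  have hn0 : n ≠ 0 := by omega
  apply le_antisymm
  · refine Ideal.span_le.2 ?_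
    rintro p ⟨hρ, hφ, hp⟩
    have hW : restrictW p = restrictZ p := congrArg restrictZ hφ
    obtain ⟨k, hk⟩ := z_mul_w_dvd_sub hp
    rw [SetLike.mem_coe, sub_eq_iff_eq_add.1 hk, hW, z_mul_w]
    refine Ideal.add_mem _ (Ideal.mul_mem_right _ _ (Ideal.subset_span (by simp)))
      (aeval_z_add_aeval_w_mem (by rw [coeff_zero_restrictZ, hp]) fun i hi => ?_)
    have hcoeff := congrArg (Polynomial.coeff · i) (restrictZ_sigmaRho n p)
    simp only [hρ, Polynomial.comp_C_mul_X_coeff] at hcoeff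
    exact (isPrimitiveRoot_zeta hn0).dvd_of_pow_eq_one i
      (mul_left_cancel₀ hi (by rw [← hcoeff, mul_one]))
  · rw [Ideal.span_le, Set.insert_subset_iff, Set.singleton_subset_iff]
    refine ⟨z_mul_w ▸ z_mul_w_mem, ?_⟩
    obtain ⟨k, hk⟩ := mul_dvd_add_pow_sub z w (Nat.one_le_iff_ne_zero.2 hn0)
    have h : X 0 ^ n = C (1 / 2) ^ n * (z ^ n + w ^ n) + C (1 / 2) ^ n * k * (z * w) := by
      have h2 := congrArg (· ^ n) C_half_mul_two
      simp only [mul_pow, one_pow] at h2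
      rw [z_add_w, mul_pow] at hk
      linear_combination (-X 0 ^ n) * h2 + C (1 / 2) ^ n * hk
    rw [SetLike.mem_coe, h]
    exact Ideal.add_mem _ (Ideal.mul_mem_left _ _ (z_pow_add_w_pow_mem hn0))
      (Ideal.mul_mem_left _ _ z_mul_w_mem)
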